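/- Let M' be a graph-preserving approximation of a POMDP M (i.e., M and M' differ only in their transition probabilities, and for all states s, s' and actions a, P(s' | s, a) > 0 if and only if P'(s' | s, a) > 0) and let φ = ⟨REACH, AVOID⟩ be a reach-avoid specification. Then every φ-shield for M' is a φ-shield for M. -/

import Mathlib

/-!
STATEMENT 3: Let `M'` be a graph-preserving approximation of a POMDP `M` (i.e., `M` and
`M'` differ only in their transition probabilities, and for all states `s, s'` and actions
`a`, `P(s' | s, a) > 0 ⟺ P'(s' | s, a) > 0`) and let `φ = ⟨REACH, AVOID⟩` be a reach-avoid
specification.  Then every `φ`-shield for `M'` is a `φ`-shield for `M`.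
-/

open scoped ENNReal

/-- A POMDP with state space `S`, actions `A`, observations `Z`. -/
structure POMDP (S A Z : Type*) where
  P : S → A → PMF S
  O : S → Z

/-- An observation-based (randomized) policy. -/
abbrev ObsPolicy (A Z : Type*) := List (Z × A) → Z → PMF A

variable {S A Z : Type*} [Fintype S] [Fintype A]

/-- The graph-based belief-support update `(B' | B, a, z)`. -/
def POMDP.supUpdate (M : POMDP S A Z) (B : Set S) (a : A) (z : Z) : Set S :=
  {s' | M.O s' = z ∧ ∃ s ∈ B, 0 < M.P s a s'}

open Classical in
/-- Probability under observation-based policy `π` (with accumulated history `h`) that the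
path from `s` visits no state of `AVOID` during the next `n` steps (incl. `s`). -/
noncomputable def POMDP.avoidProb (M : POMDP S A Z) (AVOID : Set S) (π : ObsPolicy A Z) :
    ℕ → List (Z × A) → S → ℝ≥0∞
  | 0, _, s => if s ∈ AVOID then 0 else 1
  | n + 1, h, s =>
    if s ∈ AVOID then 0
    else ∑ a : A, π h (M.O s) a *
      ∑ s' : S, M.P s a s' * M.avoidProb AVOID π n (h ++ [(M.O s, a)]) s'

open Classical in
/-- Probability under observation-based policy `π` (with accumulated history `h`) that the
path from `s` visits some state of `REACH` within the next `n` steps (incl. `s`). -/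
noncomputable def POMDP.reachProb (M : POMDP S A Z) (REACH : Set S) (π : ObsPolicy A Z) :
    ℕ → List (Z × A) → S → ℝ≥0∞
  | 0, _, s => if s ∈ REACH then 1 else 0
  | n + 1, h, s =>
    if s ∈ REACH then 1
    else ∑ a : A, π h (M.O s) a *
      ∑ s' : S, M.P s a s' * M.reachProb REACH π n (h ++ [(M.O s, a)]) s'

/-- A belief `b` is winning for the reach-avoid specification `⟨REACH, AVOID⟩` if there is
an observation-based policy under which, with probability 1, the induced path reaches
some state in `REACH` while never visiting a state in `AVOID`. -/
def POMDP.WinningBelief (M : POMDP S A Z) (REACH AVOID : Set S) (b : PMF S) : Prop :=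
  ∃ π : ObsPolicy A Z,
    (∀ n : ℕ, ∑ s : S, b s * M.avoidProb AVOID π n [] s = 1) ∧
    (⨆ n : ℕ, ∑ s : S, b s * M.reachProb REACH π n [] s) = 1

/-- A belief support `B` is winning if some belief with support `B` is winning. -/
def POMDP.WinningSupport (M : POMDP S A Z) (REACH AVOID : Set S) (B : Set S) : Prop :=
  ∃ b : PMF S, b.support = B ∧ M.WinningBelief REACH AVOID b

/-- A permissive policy `ν` is a `⟨REACH, AVOID⟩`-shield for `M` if for every belief
support `B` winning for `M`, every allowed action `a ∈ ν(B)` and every observation `z`,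
the updated belief support `(B' | B, a, z)`, whenever nonempty, is winning again. -/
def POMDP.IsShield (M : POMDP S A Z) (REACH AVOID : Set S) (ν : Set S → Set A) : Prop :=
  ∀ B : Set S, M.WinningSupport REACH AVOID B → ∀ a ∈ ν B, ∀ z : Z,
    (M.supUpdate B a z).Nonempty → M.WinningSupport REACH AVOID (M.supUpdate B a z)

namespace POMDP

/-! ### Weighted averages in `ℝ≥0∞` -/

lemma eq_one_of_weighted_sum_eq_one {ι : Type*} [Fintype ι] {w x : ι → ℝ≥0∞}
    (hw : ∑ i, w i = 1) (hx : ∀ i, x i ≤ 1) (h : ∑ i, w i * x i = 1) {i : ι}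
    (hi : 0 < w i) : x i = 1 := by
  by_contra hne
  have hlt : x i < 1 := lt_of_le_of_ne (hx i) hne
  have hle : ∀ j, w j ≤ 1 := fun j =>
    hw ▸ Finset.single_le_sum (f := w) (fun _ _ => zero_le) (Finset.mem_univ j)
  have htop : ∀ j, w j ≠ ∞ := fun j => ne_top_of_le_ne_top ENNReal.one_ne_top (hle j)
  have hsum : ∑ j, w j * x j < ∑ j, w j := by
    classical
    rw [← Finset.add_sum_erase _ _ (Finset.mem_univ i),
      ← Finset.add_sum_erase _ w (Finset.mem_univ i)]
    have hrest : ∑ j ∈ Finset.univ.erase i, w j * x j ≤ ∑ j ∈ Finset.univ.erase i, w j :=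
      Finset.sum_le_sum fun j _ => mul_le_of_le_one_right' (hx j)
    refine ENNReal.add_lt_add_of_lt_of_le ?_ ?_ hrest
    · exact ne_top_of_le_ne_top (ENNReal.sum_ne_top.mpr fun j _ => htop j) hrest
    · simpa using ENNReal.mul_lt_mul_right hi.ne' (htop i) hlt
  rw [h, hw] at hsum
  exact lt_irrefl _ hsum

lemma weighted_sum_eq_one {ι : Type*} [Fintype ι] {w x : ι → ℝ≥0∞}
    (hw : ∑ i, w i = 1) (hx : ∀ i, 0 < w i → x i = 1) : ∑ i, w i * x i = 1 := by
  rw [← hw]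
  refine Finset.sum_congr rfl fun i _ => ?_
  rcases eq_or_ne (w i) 0 with h0 | h0
  · simp [h0]
  · rw [hx i (pos_iff_ne_zero.mpr h0), mul_one]

lemma weighted_sum_le_one {ι : Type*} [Fintype ι] {w x : ι → ℝ≥0∞}
    (hw : ∑ i, w i = 1) (hx : ∀ i, x i ≤ 1) : ∑ i, w i * x i ≤ 1 := by
  rw [← hw]
  exact Finset.sum_le_sum fun i _ => mul_le_of_le_one_right' (hx i)

lemma weighted_sum_iSup {ι : Type*} [Fintype ι] (w : ι → ℝ≥0∞) {x : ι → ℕ → ℝ≥0∞}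
    (hx : ∀ i, Monotone (x i)) : ⨆ n, ∑ i, w i * x i n = ∑ i, w i * ⨆ n, x i n := by
  simp_rw [ENNReal.mul_iSup]
  exact (ENNReal.finsetSum_iSup_of_monotone fun i _ _ h => by gcongr; exact hx i h).symm

lemma sum_pmf {ι : Type*} [Fintype ι] (p : PMF ι) : ∑ i, p i = 1 := by
  rw [← tsum_fintype (L := .unconditional _)]
  exact p.tsum_coe

/-! ### One-step unfolding of the reach and avoid probabilities -/

/-- The probability of choosing action `p.1` in state `s` after history `h` and moving
to `p.2`. -/
noncomputable def stepWeight (M : POMDP S A Z) (π : ObsPolicy A Z) (h : List (Z × A)) (s : S)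
    (p : A × S) : ℝ≥0∞ :=
  π h (M.O s) p.1 * M.P s p.1 p.2

lemma sum_stepWeight (M : POMDP S A Z) (π : ObsPolicy A Z) (h : List (Z × A)) (s : S) :
    ∑ p, M.stepWeight π h s p = 1 := by
  simp only [stepWeight, Fintype.sum_prod_type, ← Finset.mul_sum, sum_pmf, mul_one]

set_option linter.unusedSectionVars false in
lemma stepWeight_pos_iff (M : POMDP S A Z) (π : ObsPolicy A Z) (h : List (Z × A)) (s : S)
    (p : A × S) :
    0 < M.stepWeight π h s p ↔ 0 < π h (M.O s) p.1 ∧ 0 < M.P s p.1 p.2 := by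
  simp [stepWeight, pos_iff_ne_zero]

lemma avoidProb_of_mem (M : POMDP S A Z) {AVOID : Set S} (π : ObsPolicy A Z) (n : ℕ)
    (h : List (Z × A)) {s : S} (hs : s ∈ AVOID) : M.avoidProb AVOID π n h s = 0 := by
  cases n <;> simp [avoidProb, hs]

lemma avoidProb_zero (M : POMDP S A Z) {AVOID : Set S} (π : ObsPolicy A Z)
    (h : List (Z × A)) {s : S} (hs : s ∉ AVOID) : M.avoidProb AVOID π 0 h s = 1 := by
  simp [avoidProb, hs]

lemma avoidProb_succ (M : POMDP S A Z) {AVOID : Set S} (π : ObsPolicy A Z) (n : ℕ)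
    (h : List (Z × A)) {s : S} (hs : s ∉ AVOID) :
    M.avoidProb AVOID π (n + 1) h s =
      ∑ p, M.stepWeight π h s p * M.avoidProb AVOID π n (h ++ [(M.O s, p.1)]) p.2 := by
  simp [avoidProb, hs, stepWeight, Fintype.sum_prod_type, Finset.mul_sum, mul_assoc]

lemma reachProb_of_mem (M : POMDP S A Z) {REACH : Set S} (π : ObsPolicy A Z) (n : ℕ)
    (h : List (Z × A)) {s : S} (hs : s ∈ REACH) : M.reachProb REACH π n h s = 1 := by
  cases n <;> simp [reachProb, hs]

lemma reachProb_zero (M : POMDP S A Z) {REACH : Set S} (π : ObsPolicy A Z)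
    (h : List (Z × A)) {s : S} (hs : s ∉ REACH) : M.reachProb REACH π 0 h s = 0 := by
  simp [reachProb, hs]

lemma reachProb_succ (M : POMDP S A Z) {REACH : Set S} (π : ObsPolicy A Z) (n : ℕ)
    (h : List (Z × A)) {s : S} (hs : s ∉ REACH) :
    M.reachProb REACH π (n + 1) h s =
      ∑ p, M.stepWeight π h s p * M.reachProb REACH π n (h ++ [(M.O s, p.1)]) p.2 := by
  simp [reachProb, hs, stepWeight, Fintype.sum_prod_type, Finset.mul_sum, mul_assoc]

lemma avoidProb_le_one (M : POMDP S A Z) (AVOID : Set S) (π : ObsPolicy A Z) (n : ℕ)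
    (h : List (Z × A)) (s : S) : M.avoidProb AVOID π n h s ≤ 1 := by
  induction n generalizing h s with
  | zero =>
    by_cases hs : s ∈ AVOID
    · simp [avoidProb_of_mem M π 0 h hs]
    · rw [avoidProb_zero M π h hs]
  | succ n ih =>
    by_cases hs : s ∈ AVOID
    · simp [avoidProb_of_mem M π _ h hs]
    · rw [avoidProb_succ M π n h hs]
      exact weighted_sum_le_one (M.sum_stepWeight π h s) fun _ => ih _ _

lemma reachProb_le_one (M : POMDP S A Z) (REACH : Set S) (π : ObsPolicy A Z) (n : ℕ)
    (h : List (Z × A)) (s : S) : M.reachProb REACH π n h s ≤ 1 := by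
  induction n generalizing h s with
  | zero =>
    by_cases hs : s ∈ REACH
    · rw [reachProb_of_mem M π 0 h hs]
    · simp [reachProb_zero M π h hs]
  | succ n ih =>
    by_cases hs : s ∈ REACH
    · rw [reachProb_of_mem M π _ h hs]
    · rw [reachProb_succ M π n h hs]
      exact weighted_sum_le_one (M.sum_stepWeight π h s) fun _ => ih _ _

lemma monotone_reachProb (M : POMDP S A Z) (REACH : Set S) (π : ObsPolicy A Z)
    (h : List (Z × A)) (s : S) : Monotone fun n => M.reachProb REACH π n h s := by
  refine monotone_nat_of_le_succ fun n => ?_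
  induction n generalizing h s with
  | zero =>
    by_cases hs : s ∈ REACH
    · simp only [reachProb_of_mem M π _ h hs, le_refl]
    · simp [reachProb_zero M π h hs]
  | succ n ih =>
    by_cases hs : s ∈ REACH
    · simp only [reachProb_of_mem M π _ h hs, le_refl]
    · rw [reachProb_succ M π n h hs, reachProb_succ M π (n + 1) h hs]
      exact Finset.sum_le_sum fun p _ => by gcongr; exact ih _ _

/-- The probability of eventually reaching `REACH`. -/
noncomputable def reachLimit (M : POMDP S A Z) (REACH : Set S) (π : ObsPolicy A Z)
    (h : List (Z × A)) (s : S) : ℝ≥0∞ :=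
  ⨆ n, M.reachProb REACH π n h s

lemma reachLimit_le_one (M : POMDP S A Z) (REACH : Set S) (π : ObsPolicy A Z)
    (h : List (Z × A)) (s : S) : M.reachLimit REACH π h s ≤ 1 :=
  iSup_le fun n => M.reachProb_le_one REACH π n h s

lemma reachProb_le_reachLimit (M : POMDP S A Z) (REACH : Set S) (π : ObsPolicy A Z) (n : ℕ)
    (h : List (Z × A)) (s : S) : M.reachProb REACH π n h s ≤ M.reachLimit REACH π h s :=
  le_iSup (fun n => M.reachProb REACH π n h s) n

lemma reachLimit_eq_sum (M : POMDP S A Z) {REACH : Set S} (π : ObsPolicy A Z)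
    (h : List (Z × A)) {s : S} (hs : s ∉ REACH) :
    M.reachLimit REACH π h s =
      ∑ p, M.stepWeight π h s p * M.reachLimit REACH π (h ++ [(M.O s, p.1)]) p.2 := by
  simp only [reachLimit]
  rw [← weighted_sum_iSup _ fun p : A × S => M.monotone_reachProb REACH π _ p.2,
    ← (M.monotone_reachProb REACH π h s).iSup_nat_add 1]
  simp_rw [reachProb_succ M π _ h hs]

lemma winningBelief_iff (M : POMDP S A Z) (REACH AVOID : Set S) (b : PMF S) :
    M.WinningBelief REACH AVOID b ↔ ∃ π : ObsPolicy A Z, ∀ s ∈ b.support,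
      (∀ n, M.avoidProb AVOID π n [] s = 1) ∧ M.reachLimit REACH π [] s = 1 := by
  have hpos : ∀ {s}, s ∈ b.support ↔ 0 < b s := by simp [PMF.mem_support_iff, pos_iff_ne_zero]
  refine exists_congr fun π => ?_
  rw [weighted_sum_iSup _ fun s => M.monotone_reachProb REACH π [] s]
  constructor
  · rintro ⟨ha, hr⟩ s hs
    exact ⟨fun n => eq_one_of_weighted_sum_eq_one (sum_pmf b)
        (M.avoidProb_le_one AVOID π n []) (ha n) (hpos.mp hs),
      eq_one_of_weighted_sum_eq_one (sum_pmf b) (M.reachLimit_le_one REACH π []) hr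
        (hpos.mp hs)⟩
  · intro hb
    exact ⟨fun n => weighted_sum_eq_one (sum_pmf b) fun s hs => (hb s (hpos.mpr hs)).1 n,
      weighted_sum_eq_one (sum_pmf b) fun s hs => (hb s (hpos.mpr hs)).2⟩

/-! ### Supports annotated with the states that still have to reach `REACH` -/

/-- The pair `(B, U)` records the states `B` that are possible now and the states `U` that
are possible on paths that did not visit `REACH` before. This is its update when `x.1` is
observed and action `x.2` is played. -/
def trackStep (M : POMDP S A Z) (REACH : Set S) (m : Set S × Set S) (x : Z × A) :
    Set S × Set S :=
  ({s' | ∃ s ∈ m.1, M.O s = x.1 ∧ 0 < M.P s x.2 s'},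
    {s' | ∃ s ∈ m.2, s ∉ REACH ∧ M.O s = x.1 ∧ 0 < M.P s x.2 s'})

/-- The policy `π` continued after history `h` is winning from the tracked pair `m`. -/
def WinsAfter (M : POMDP S A Z) (REACH AVOID : Set S) (π : ObsPolicy A Z)
    (h : List (Z × A)) (m : Set S × Set S) : Prop :=
  (∀ s ∈ m.1, ∀ n, M.avoidProb AVOID π n h s = 1) ∧
    ∀ s ∈ m.2, M.reachLimit REACH π h s = 1

/-- Some policy is winning from the tracked pair `m`. -/
def WinningTrack (M : POMDP S A Z) (REACH AVOID : Set S) (m : Set S × Set S) : Prop :=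
  ∃ π h, M.WinsAfter REACH AVOID π h m

lemma WinsAfter.trackStep {M : POMDP S A Z} {REACH AVOID : Set S} {π : ObsPolicy A Z}
    {h : List (Z × A)} {m : Set S × Set S} (hm : M.WinsAfter REACH AVOID π h m) {z : Z} {a : A}
    (ha : 0 < π h z a) :
    M.WinsAfter REACH AVOID π (h ++ [(z, a)]) (M.trackStep REACH m (z, a)) := by
  constructor
  · rintro s' ⟨s, hs, rfl, hP⟩ n
    have hsA : s ∉ AVOID := fun hA => by
      have := hm.1 s hs 0
      simp [avoidProb_of_mem M π 0 h hA] at this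
    have h1 := hm.1 s hs (n + 1)
    rw [avoidProb_succ M π n h hsA] at h1
    exact eq_one_of_weighted_sum_eq_one (i := (a, s')) (M.sum_stepWeight π h s)
      (fun _ => M.avoidProb_le_one _ _ _ _ _) h1
      ((M.stepWeight_pos_iff π h s _).mpr ⟨ha, hP⟩)
  · rintro s' ⟨s, hs, hsR, rfl, hP⟩
    have h1 := hm.2 s hs
    rw [reachLimit_eq_sum M π h hsR] at h1
    exact eq_one_of_weighted_sum_eq_one (i := (a, s')) (M.sum_stepWeight π h s)
      (fun _ => M.reachLimit_le_one _ _ _ _) h1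
      ((M.stepWeight_pos_iff π h s _).mpr ⟨ha, hP⟩)

/-- The actions that keep the tracked pair winning. -/
def safeActions (M : POMDP S A Z) (REACH AVOID : Set S) (m : Set S × Set S) (z : Z) : Set A :=
  {a | M.WinningTrack REACH AVOID (M.trackStep REACH m (z, a))}

lemma WinningTrack.safeActions_nonempty {M : POMDP S A Z} {REACH AVOID : Set S}
    {m : Set S × Set S} (hm : M.WinningTrack REACH AVOID m) (z : Z) :
    (M.safeActions REACH AVOID m z).Nonempty := by
  obtain ⟨π, h, hm⟩ := hm
  obtain ⟨a, ha⟩ := (π h z).support_nonempty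
  exact ⟨a, π, _, hm.trackStep (pos_iff_ne_zero.mpr ((PMF.mem_support_iff _ _).mp ha))⟩

open Classical in
/-- The policy that tracks the pair `(B, U)` from the initial value `m₀` and plays uniformly
among the safe actions. -/
noncomputable def safePolicy [Nonempty A] (M : POMDP S A Z) (REACH AVOID : Set S)
    (m₀ : Set S × Set S) : ObsPolicy A Z := fun h z =>
  if hne : (M.safeActions REACH AVOID (h.foldl (M.trackStep REACH) m₀) z).toFinset.Nonempty then
    PMF.uniformOfFinset _ hne
  else PMF.pure (Classical.arbitrary A)

section SafePolicy

variable [Nonempty A] {M M' : POMDP S A Z} {REACH AVOID : Set S} {m₀ : Set S × Set S}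

lemma safePolicy_pos_iff {h : List (Z × A)}
    (hm : M.WinningTrack REACH AVOID (h.foldl (M.trackStep REACH) m₀)) (z : Z) (a : A) :
    0 < M.safePolicy REACH AVOID m₀ h z a ↔
      M.WinningTrack REACH AVOID ((h ++ [(z, a)]).foldl (M.trackStep REACH) m₀) := by
  classical
  have hne := Set.toFinset_nonempty.mpr (hm.safeActions_nonempty z)
  simp only [safePolicy]
  rw [dif_pos (by convert hne), pos_iff_ne_zero, ← PMF.mem_support_iff]
  simp only [PMF.support_uniformOfFinset, Finset.mem_coe, Set.mem_toFinset, List.foldl_append]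
  rfl

lemma inv_card_le_safePolicy {h : List (Z × A)} {z : Z} {a : A}
    (ha : 0 < M.safePolicy REACH AVOID m₀ h z a) :
    (Fintype.card A : ℝ≥0∞)⁻¹ ≤ M.safePolicy REACH AVOID m₀ h z a := by
  classical
  simp only [safePolicy] at ha ⊢
  split_ifs at ha ⊢ with hne
  · rw [PMF.uniformOfFinset_apply] at ha ⊢
    split_ifs at ha ⊢ with hmem
    · gcongr
      exact Finset.card_le_univ _
    · simp at ha
  · rw [PMF.pure_apply] at ha ⊢
    split_ifs at ha ⊢ with hmem
    · simp [Nat.one_le_iff_ne_zero]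
    · simp at ha

lemma avoidProb_safePolicy (hO : M'.O = M.O)
    (hgraph : ∀ (s : S) (a : A) (s' : S), 0 < M.P s a s' ↔ 0 < M'.P s a s')
    {h : List (Z × A)} (hm : M.WinningTrack REACH AVOID (h.foldl (M.trackStep REACH) m₀))
    {s : S} (hs : s ∈ (h.foldl (M.trackStep REACH) m₀).1) (n : ℕ) :
    M'.avoidProb AVOID (M.safePolicy REACH AVOID m₀) n h s = 1 := by
  have hsA : s ∉ AVOID := fun hA => by
    obtain ⟨π, h', hm⟩ := hm
    have := hm.1 s hs 0
    simp [avoidProb_of_mem M π 0 h' hA] at this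
  induction n generalizing h s with
  | zero => exact avoidProb_zero M' _ h hsA
  | succ n ih =>
    rw [avoidProb_succ M' _ n h hsA]
    refine weighted_sum_eq_one (M'.sum_stepWeight _ h s) fun p hp => ?_
    obtain ⟨hσ, hP⟩ := (M'.stepWeight_pos_iff _ h s p).mp hp
    have hwin := (safePolicy_pos_iff hm _ _).mp hσ
    have hmem : p.2 ∈ ((h ++ [(M'.O s, p.1)]).foldl (M.trackStep REACH) m₀).1 := by
      rw [List.foldl_append]
      exact ⟨s, hs, by rw [hO], (hgraph _ _ _).mpr hP⟩
    refine ih hwin hmem fun hA => ?_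
    obtain ⟨π, h', hm⟩ := hwin
    have := hm.1 _ hmem 0
    simp [avoidProb_of_mem M π 0 h' hA] at this

/-- A winning policy for `M` that reaches `REACH` within `n` steps with positive probability
yields a lower bound for the safe policy in `M'`. -/
lemma pow_le_reachProb_safePolicy (hO : M'.O = M.O)
    (hgraph : ∀ (s : S) (a : A) (s' : S), 0 < M.P s a s' ↔ 0 < M'.P s a s') {δ : ℝ≥0∞}
    (hδ1 : δ ≤ 1)
    (hδ : ∀ h s p, 0 < M'.stepWeight (M.safePolicy REACH AVOID m₀) h s p →
      δ ≤ M'.stepWeight (M.safePolicy REACH AVOID m₀) h s p)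
    {π : ObsPolicy A Z} {n : ℕ} {h' h : List (Z × A)} {s : S}
    (hm : M.WinsAfter REACH AVOID π h' (h.foldl (M.trackStep REACH) m₀))
    (hs : s ∈ (h.foldl (M.trackStep REACH) m₀).2) (hr : 0 < M.reachProb REACH π n h' s) :
    δ ^ n ≤ M'.reachProb REACH (M.safePolicy REACH AVOID m₀) n h s := by
  induction n generalizing h h' s with
  | zero =>
    have hsR : s ∈ REACH := by
      by_contra hsR
      simp [reachProb_zero M π h' hsR] at hr
    simp [reachProb_of_mem M' _ 0 h hsR]
  | succ n ih =>
    by_cases hsR : s ∈ REACH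
    · rw [reachProb_of_mem M' _ _ h hsR]
      exact pow_le_one' hδ1 _
    · rw [reachProb_succ M π n h' hsR] at hr
      obtain ⟨p, -, hp⟩ := Finset.exists_ne_zero_of_sum_ne_zero hr.ne'
      obtain ⟨hw, hr'⟩ := mul_ne_zero_iff.mp hp
      obtain ⟨hπ, hP⟩ := (M.stepWeight_pos_iff π h' s p).mp (pos_iff_ne_zero.mpr hw)
      have hwin := hm.trackStep hπ
      have hfold : (h ++ [(M.O s, p.1)]).foldl (M.trackStep REACH) m₀ =
          M.trackStep REACH (h.foldl (M.trackStep REACH) m₀) (M.O s, p.1) := by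
        simp [List.foldl_append]
      rw [← hfold] at hwin
      have hσ := (safePolicy_pos_iff ⟨π, h', hm⟩ (M.O s) p.1).mpr ⟨π, _, hwin⟩
      have hmem : p.2 ∈ ((h ++ [(M.O s, p.1)]).foldl (M.trackStep REACH) m₀).2 := by
        rw [hfold]
        exact ⟨s, hs, hsR, rfl, hP⟩
      have hrec := ih hwin hmem (pos_iff_ne_zero.mpr hr')
      rw [← hO] at hσ hrec
      rw [reachProb_succ M' _ n h hsR, pow_succ']
      calc δ * δ ^ n ≤ _ := mul_le_mul'
            (hδ h s p ((M'.stepWeight_pos_iff _ h s p).mpr ⟨hσ, (hgraph _ _ _).mp hP⟩)) hrec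
        _ ≤ _ := Finset.single_le_sum
            (f := fun p => M'.stepWeight (M.safePolicy REACH AVOID m₀) h s p *
              M'.reachProb REACH (M.safePolicy REACH AVOID m₀) n (h ++ [(M'.O s, p.1)]) p.2)
            (fun _ _ => zero_le) (Finset.mem_univ p)

lemma exists_pos_le_stepWeight_safePolicy (M M' : POMDP S A Z) (REACH AVOID : Set S)
    (m₀ : Set S × Set S) :
    ∃ δ : ℝ≥0∞, 0 < δ ∧ δ ≤ 1 ∧
      ∀ h s p, 0 < M'.stepWeight (M.safePolicy REACH AVOID m₀) h s p →
        δ ≤ M'.stepWeight (M.safePolicy REACH AVOID m₀) h s p := by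
  classical
  let f : S × A × S → ℝ≥0∞ := fun t => if 0 < M'.P t.1 t.2.1 t.2.2 then M'.P t.1 t.2.1 t.2.2 else 1
  let c : ℝ≥0∞ := Finset.univ.inf f ⊓ 1
  have hc : 0 < c := by
    refine lt_min ((Finset.lt_inf_iff (by simp)).mpr fun t _ => ?_) one_pos
    simp only [f]
    split_ifs with h
    exacts [h, one_pos]
  refine ⟨(Fintype.card A : ℝ≥0∞)⁻¹ * c, ?_, ?_, fun h s p hp => ?_⟩
  · exact ENNReal.mul_pos (by simp) hc.ne'
  · refine mul_le_one' ?_ inf_le_right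
    rw [ENNReal.inv_le_one]
    exact_mod_cast Fintype.card_pos
  · obtain ⟨hσ, hP⟩ := (M'.stepWeight_pos_iff _ h s p).mp hp
    refine mul_le_mul' (inv_card_le_safePolicy hσ) ?_
    refine (inf_le_left.trans (Finset.inf_le (Finset.mem_univ (s, p.1, p.2)))).trans ?_
    simp [f, hP]

/-- Within a fixed horizon the safe policy reaches `REACH` with probability bounded below,
uniformly over all winning histories. -/
lemma exists_uniform_reachProb_safePolicy (hO : M'.O = M.O)
    (hgraph : ∀ (s : S) (a : A) (s' : S), 0 < M.P s a s' ↔ 0 < M'.P s a s') :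
    ∃ (N : ℕ) (ε : ℝ≥0∞), 0 < ε ∧ ∀ (h : List (Z × A)) (s : S),
      M.WinningTrack REACH AVOID (h.foldl (M.trackStep REACH) m₀) →
      s ∈ (h.foldl (M.trackStep REACH) m₀).2 →
      ε ≤ M'.reachProb REACH (M.safePolicy REACH AVOID m₀) N h s := by
  obtain ⟨δ, hδ0, hδ1, hδ⟩ := exists_pos_le_stepWeight_safePolicy M M' REACH AVOID m₀
  have hpos : ∀ t : (Set S × Set S) × S, ∃ n, M.WinningTrack REACH AVOID t.1 → t.2 ∈ t.1.2 →
      ∃ π h', M.WinsAfter REACH AVOID π h' t.1 ∧ 0 < M.reachProb REACH π n h' t.2 := by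
    rintro ⟨m, s⟩
    by_cases hm : M.WinningTrack REACH AVOID m ∧ s ∈ m.2
    · obtain ⟨⟨π, h', hm⟩, hs⟩ := hm
      have hlim : 0 < M.reachLimit REACH π h' s := by
        rw [hm.2 s hs]
        exact one_pos
      obtain ⟨n, hn⟩ := lt_iSup_iff.mp hlim
      exact ⟨n, fun _ _ => ⟨π, h', hm, hn⟩⟩
    · exact ⟨0, fun h1 h2 => (hm ⟨h1, h2⟩).elim⟩
  choose n hn using hpos
  obtain ⟨N, hN⟩ := (Set.finite_range n).bddAbove
  refine ⟨N, δ ^ N, pos_iff_ne_zero.mpr (pow_ne_zero _ hδ0.ne'), fun h s hm hs => ?_⟩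
  obtain ⟨π, h', hwin, hr⟩ := hn (h.foldl (M.trackStep REACH) m₀, s) hm hs
  have hle : n (h.foldl (M.trackStep REACH) m₀, s) ≤ N := hN ⟨_, rfl⟩
  exact pow_le_reachProb_safePolicy hO hgraph hδ1 hδ hwin hs
    (hr.trans_le (M.monotone_reachProb REACH π h' s hle))

/-- If `q` bounds the limit reach probability from below at all winning histories, then
restarting after `n` steps gives `r + (1 - r) q ≤ v`, with `r` the probability of reaching
within `n` steps and `v` the limit reach probability. -/
lemma reachProb_add_le_reachLimit_safePolicy (hO : M'.O = M.O)
    (hgraph : ∀ (s : S) (a : A) (s' : S), 0 < M.P s a s' ↔ 0 < M'.P s a s') {q : ℝ≥0∞}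
    (hq : ∀ (h : List (Z × A)) (s : S),
      M.WinningTrack REACH AVOID (h.foldl (M.trackStep REACH) m₀) →
      s ∈ (h.foldl (M.trackStep REACH) m₀).2 →
      q ≤ M'.reachLimit REACH (M.safePolicy REACH AVOID m₀) h s)
    {h : List (Z × A)} {s : S}
    (hm : M.WinningTrack REACH AVOID (h.foldl (M.trackStep REACH) m₀))
    (hs : s ∈ (h.foldl (M.trackStep REACH) m₀).2) (n : ℕ) :
    M'.reachProb REACH (M.safePolicy REACH AVOID m₀) n h s + q ≤
      M'.reachLimit REACH (M.safePolicy REACH AVOID m₀) h s +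
        M'.reachProb REACH (M.safePolicy REACH AVOID m₀) n h s * q := by
  have hmemR : ∀ {h : List (Z × A)} {s : S} (n : ℕ), s ∈ REACH →
      M'.reachProb REACH (M.safePolicy REACH AVOID m₀) n h s + q ≤
      M'.reachLimit REACH (M.safePolicy REACH AVOID m₀) h s +
        M'.reachProb REACH (M.safePolicy REACH AVOID m₀) n h s * q := fun {h s} n hsR => by
    have hlim := M'.reachProb_le_reachLimit REACH (M.safePolicy REACH AVOID m₀) n h s
    rw [reachProb_of_mem M' _ n h hsR] at hlim ⊢
    rw [one_mul]
    gcongr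
  induction n generalizing h s with
  | zero =>
    by_cases hsR : s ∈ REACH
    · exact hmemR 0 hsR
    · simpa [reachProb_zero M' _ h hsR] using hq h s hm hs
  | succ n ih =>
    by_cases hsR : s ∈ REACH
    · exact hmemR _ hsR
    · rw [reachProb_succ M' _ n h hsR, reachLimit_eq_sum M' _ h hsR, Finset.sum_mul,
        ← Finset.sum_add_distrib]
      nth_rewrite 1 [← one_mul q]
      rw [← M'.sum_stepWeight (M.safePolicy REACH AVOID m₀) h s, Finset.sum_mul,
        ← Finset.sum_add_distrib]
      refine Finset.sum_le_sum fun p _ => ?_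
      rw [mul_assoc, ← mul_add, ← mul_add]
      rcases eq_or_ne (M'.stepWeight (M.safePolicy REACH AVOID m₀) h s p) 0 with hw | hw
      · simp [hw]
      · obtain ⟨hσ, hP⟩ := (M'.stepWeight_pos_iff _ h s p).mp (pos_iff_ne_zero.mpr hw)
        refine mul_le_mul_right (ih ((safePolicy_pos_iff hm _ _).mp hσ) ?_) _
        rw [List.foldl_append]
        exact ⟨s, hs, hsR, by rw [hO], (hgraph _ _ _).mpr hP⟩

lemma reachLimit_safePolicy (hO : M'.O = M.O)
    (hgraph : ∀ (s : S) (a : A) (s' : S), 0 < M.P s a s' ↔ 0 < M'.P s a s')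
    {h : List (Z × A)} {s : S}
    (hm : M.WinningTrack REACH AVOID (h.foldl (M.trackStep REACH) m₀))
    (hs : s ∈ (h.foldl (M.trackStep REACH) m₀).2) :
    M'.reachLimit REACH (M.safePolicy REACH AVOID m₀) h s = 1 := by
  obtain ⟨N, ε, hε, hN⟩ := exists_uniform_reachProb_safePolicy (REACH := REACH)
    (AVOID := AVOID) (m₀ := m₀) hO hgraph
  let q : ℝ≥0∞ := ⨅ (h : List (Z × A)) (s : S)
    (_ : M.WinningTrack REACH AVOID (h.foldl (M.trackStep REACH) m₀))
    (_ : s ∈ (h.foldl (M.trackStep REACH) m₀).2),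
    M'.reachLimit REACH (M.safePolicy REACH AVOID m₀) h s
  have hq : ∀ (h : List (Z × A)) (s : S),
      M.WinningTrack REACH AVOID (h.foldl (M.trackStep REACH) m₀) →
      s ∈ (h.foldl (M.trackStep REACH) m₀).2 →
      q ≤ M'.reachLimit REACH (M.safePolicy REACH AVOID m₀) h s := fun h s hm hs =>
    iInf_le_of_le h (iInf_le_of_le s (iInf_le_of_le hm (iInf_le_of_le hs le_rfl)))
  have hq1 : q ≤ 1 := (hq h s hm hs).trans (M'.reachLimit_le_one _ _ _ _)
  have hqtop : q ≠ ∞ := ne_top_of_le_ne_top ENNReal.one_ne_top hq1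
  obtain ⟨d, hd⟩ := exists_add_of_le hq1
  have hgap : ε * d + q ≤ q := by
    refine le_iInf fun h => le_iInf fun s => le_iInf fun hm => le_iInf fun hs => ?_
    have hle := reachProb_add_le_reachLimit_safePolicy hO hgraph hq hm hs N
    have hr := hN h s hm hs
    have hr1 := M'.reachProb_le_one REACH (M.safePolicy REACH AVOID m₀) N h s
    generalize M'.reachProb REACH (M.safePolicy REACH AVOID m₀) N h s = r at hle hr hr1
    have hrq : r * q ≠ ∞ :=
      ENNReal.mul_ne_top (ne_top_of_le_ne_top ENNReal.one_ne_top hr1) hqtop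
    have hsplit : r = r * d + r * q := by rw [← mul_add, add_comm d, ← hd, mul_one]
    refine le_trans (by gcongr) ((ENNReal.add_le_add_iff_right hrq).mp
      (le_trans (le_of_eq ?_) hle) : r * d + q ≤ _)
    rw [add_right_comm, ← hsplit]
  have hzero : ε * d = 0 := by
    have : ε * d + q ≤ 0 + q := by rwa [zero_add]
    exact nonpos_iff_eq_zero.mp ((ENNReal.add_le_add_iff_right hqtop).mp this)
  have hd0 : d = 0 := (mul_eq_zero.mp hzero).resolve_left hε.ne'
  rw [hd0, add_zero] at hd
  exact le_antisymm (M'.reachLimit_le_one _ _ _ _) (hd ▸ hq h s hm hs)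

end SafePolicy

/-- Winning belief supports only depend on the graph of the POMDP. -/
lemma WinningSupport.of_graph_preserving {M M' : POMDP S A Z} (hO : M'.O = M.O)
    (hgraph : ∀ (s : S) (a : A) (s' : S), 0 < M.P s a s' ↔ 0 < M'.P s a s')
    {REACH AVOID B : Set S} (hB : M.WinningSupport REACH AVOID B) :
    M'.WinningSupport REACH AVOID B := by
  obtain ⟨b, rfl, hb⟩ := hB
  obtain ⟨π, hπ⟩ := (M.winningBelief_iff REACH AVOID b).mp hb
  obtain ⟨s₀, -⟩ := b.support_nonempty
  obtain ⟨a₀, -⟩ := (π [] (M.O s₀)).support_nonempty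
  have : Nonempty A := ⟨a₀⟩
  have hwin : M.WinningTrack REACH AVOID
      (([] : List (Z × A)).foldl (M.trackStep REACH) (b.support, b.support)) :=
    ⟨π, [], fun s hs => (hπ s hs).1, fun s hs => (hπ s hs).2⟩
  exact ⟨b, rfl, (M'.winningBelief_iff REACH AVOID b).mpr
    ⟨M.safePolicy REACH AVOID (b.support, b.support), fun s hs =>
      ⟨avoidProb_safePolicy hO hgraph hwin hs, reachLimit_safePolicy hO hgraph hwin hs⟩⟩⟩

set_option linter.unusedSectionVars false in
lemma supUpdate_congr {M M' : POMDP S A Z} (hO : M'.O = M.O)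
    (hgraph : ∀ (s : S) (a : A) (s' : S), 0 < M.P s a s' ↔ 0 < M'.P s a s')
    (B : Set S) (a : A) (z : Z) : M'.supUpdate B a z = M.supUpdate B a z := by
  simp only [supUpdate, hO, hgraph]

end POMDP

/-- If `M'` is a graph-preserving approximation of `M` (same states,
actions, observations and observation function; transition probabilities are positive in
`M` iff they are positive in `M'`), then every `⟨REACH, AVOID⟩`-shield for `M'` is a
`⟨REACH, AVOID⟩`-shield for `M`. -/
theorem shield_of_graph_preserving (M M' : POMDP S A Z)
    (hO : M'.O = M.O)
    (hgraph : ∀ (s : S) (a : A) (s' : S), 0 < M.P s a s' ↔ 0 < M'.P s a s')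
    (REACH AVOID : Set S) (ν : Set S → Set A)
    (hshield : M'.IsShield REACH AVOID ν) :
    M.IsShield REACH AVOID ν := by
  intro B hB a ha z hne
  rw [← POMDP.supUpdate_congr hO hgraph] at hne ⊢
  exact (hshield B (hB.of_graph_preserving hO hgraph) a ha z hne).of_graph_preserving hO.symm
    fun s a s' => (hgraph s a s').symm
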